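/- arXiv:0709.4472 — 10 statements merged into one kernel-verified Lean document; each statement's English description precedes it below -/
import Mathlib

section
/- Let u(x,y) = x^(4/3) − y^(4/3) (real powers). Then at every point (x,y) with x > 0 and y > 0, u satisfies the Aronsson equation u_xx·u_x² + 2·u_xy·u_x·u_y + u_yy·u_y² = 0, and moreover the polynomial identity 27·x⁴·y⁴·u³ = (x⁴ − y⁴ − u³)³ holds. -/
/-- The first derivative of `t ↦ t ^ (4/3)`, valid on the whole real line. -/
lemma hasDerivAt_rpow_four_thirds (t : ℝ) :
    HasDerivAt (fun s : ℝ => s ^ ((4 : ℝ) / 3)) (4 / 3 * t ^ ((1 : ℝ) / 3)) t := by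
  have h := Real.hasDerivAt_rpow_const (x := t) (p := (4 : ℝ) / 3) (Or.inr (by norm_num))
  norm_num at h ⊢
  exact h

lemma hasDerivAt_rpow_one_third {t : ℝ} (ht : 0 < t) :
    HasDerivAt (fun s : ℝ => 4 / 3 * s ^ ((1 : ℝ) / 3)) (4 / 9 * t ^ (-(2 : ℝ) / 3)) t := by
  have h := (Real.hasDerivAt_rpow_const (x := t) (p := (1 : ℝ) / 3)
    (Or.inl ht.ne')).const_mul (4 / 3 : ℝ)
  refine h.congr_deriv ?_
  rw [show (1 : ℝ) / 3 - 1 = -(2 : ℝ) / 3 by norm_num]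
  ring

lemma rpow_neg_two_thirds_mul_sq {t : ℝ} (ht : 0 < t) :
    t ^ (-(2 : ℝ) / 3) * (t ^ ((1 : ℝ) / 3)) ^ 2 = 1 := by
  rw [← Real.rpow_mul_natCast ht.le, ← Real.rpow_add ht]
  norm_num

lemma rpow_four_thirds_pow_three {t : ℝ} (ht : 0 ≤ t) :
    (t ^ ((4 : ℝ) / 3)) ^ 3 = t ^ 4 := by
  rw [← Real.rpow_mul_natCast ht, ← Real.rpow_natCast t 4]
  norm_num

/-- Let `u(x,y) = x^(4/3) − y^(4/3)` (real powers). Then at every point `(x,y)` with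
`x > 0` and `y > 0`, `u` satisfies the Aronsson equation
`u_xx·u_x² + 2·u_xy·u_x·u_y + u_yy·u_y² = 0`, and moreover the polynomial identity
`27·x⁴·y⁴·u³ = (x⁴ − y⁴ − u³)³` holds. -/
theorem aronsson_example (x y : ℝ) (hx : 0 < x) (hy : 0 < y)
    (u : ℝ → ℝ → ℝ) (hu : ∀ a b : ℝ, u a b = a ^ ((4 : ℝ)/3) - b ^ ((4 : ℝ)/3)) :
    (deriv (fun a => deriv (fun a' => u a' y) a) x) * (deriv (fun a => u a y) x) ^ 2
      + 2 * (deriv (fun b => deriv (fun a => u a b) x) y)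
          * (deriv (fun a => u a y) x) * (deriv (fun b => u x b) y)
      + (deriv (fun b => deriv (fun b' => u x b') b) y) * (deriv (fun b => u x b) y) ^ 2 = 0
    ∧ 27 * x ^ 4 * y ^ 4 * (u x y) ^ 3 = (x ^ 4 - y ^ 4 - (u x y) ^ 3) ^ 3 := by
  have hux (b : ℝ) (a : ℝ) : deriv (fun a => u a b) a = 4 / 3 * a ^ ((1 : ℝ) / 3) := by
    simp only [hu]
    exact ((hasDerivAt_rpow_four_thirds a).sub_const _).deriv
  have huy (b : ℝ) : deriv (fun b => u x b) b = -(4 / 3 * b ^ ((1 : ℝ) / 3)) := by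
    simp only [hu]
    exact ((hasDerivAt_rpow_four_thirds b).const_sub _).deriv
  constructor
  · simp only [hux, huy, deriv_const]
    rw [(hasDerivAt_rpow_one_third hx).deriv, (hasDerivAt_rpow_one_third hy).fun_neg.deriv]
    linear_combination (64 / 81) * rpow_neg_two_thirds_mul_sq hx
      - (64 / 81) * rpow_neg_two_thirds_mul_sq hy
  · rw [hu, ← rpow_four_thirds_pow_three hx.le, ← rpow_four_thirds_pow_three hy.le]
    ring
end

section
/- For every real number γ with |γ| > 1 and every integer N ≥ 2, the characteristic equation (2N−1)(γ+1)k² − 2(N²γ + 2N − 1)k + N²(γ+1) = 0 has exactly two distinct real roots k₁ and k₂, and they satisfy k₁ < 1 < k₂. In particular there is a unique root k > 1. -/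
/-- A real quadratic whose value at `x` has sign opposite to its leading coefficient has exactly
two roots, one on each side of `x`. -/
theorem exists_roots_of_leadingCoeff_mul_eval_neg {a b c x : ℝ}
    (h : a * (a * x ^ 2 + b * x + c) < 0) :
    ∃ k₁ k₂ : ℝ, k₁ < x ∧ x < k₂ ∧ ∀ k : ℝ, a * k ^ 2 + b * k + c = 0 ↔ k = k₁ ∨ k = k₂ := by
  have ha : a ≠ 0 := by
    rintro rfl
    simp at h
  have hdisc : (2 * a * x + b) ^ 2 < discrim a b c := by
    unfold discrim
    linarith
  set s := √(discrim a b c)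
  have hs : discrim a b c = s * s :=
    (Real.mul_self_sqrt ((sq_nonneg _).trans hdisc.le)).symm
  obtain ⟨hlow, hupp⟩ := abs_lt.mp (Real.lt_sqrt_of_sq_lt (by rwa [sq_abs]) :
    |2 * a * x + b| < s)
  rcases ha.lt_or_gt with ha' | ha'
  · refine ⟨(-b + s) / (2 * a), (-b - s) / (2 * a), ?_, ?_, fun k => ?_⟩
    · rw [div_lt_iff_of_neg (by linarith)]
      linarith
    · rw [lt_div_iff_of_neg (by linarith)]
      linarith
    · rw [pow_two, quadratic_eq_zero_iff ha hs]
  · refine ⟨(-b - s) / (2 * a), (-b + s) / (2 * a), ?_, ?_, fun k => ?_⟩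
    · rw [div_lt_iff₀ (by linarith)]
      linarith
    · rw [lt_div_iff₀ (by linarith)]
      linarith
    · rw [pow_two, quadratic_eq_zero_iff ha hs, or_comm]

/-- For every real `γ` with `|γ| > 1` and every integer `N ≥ 2`, the characteristic
equation `(2N−1)(γ+1)k² − 2(N²γ+2N−1)k + N²(γ+1) = 0` has exactly two distinct real
roots `k₁ < 1 < k₂`; in particular there is a unique root `k > 1`. -/
theorem char_eq_two_roots (γ : ℝ) (hγ : 1 < |γ|) (N : ℕ) (hN : 2 ≤ N) :
    (∃ k₁ k₂ : ℝ, k₁ < 1 ∧ 1 < k₂ ∧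
      ∀ k : ℝ, (2 * (N : ℝ) - 1) * (γ + 1) * k ^ 2
          - 2 * ((N : ℝ) ^ 2 * γ + 2 * (N : ℝ) - 1) * k + (N : ℝ) ^ 2 * (γ + 1) = 0
        ↔ (k = k₁ ∨ k = k₂))
    ∧ (∃! k : ℝ, 1 < k ∧
        (2 * (N : ℝ) - 1) * (γ + 1) * k ^ 2
          - 2 * ((N : ℝ) ^ 2 * γ + 2 * (N : ℝ) - 1) * k + (N : ℝ) ^ 2 * (γ + 1) = 0) := by
  have hN' : (2 : ℝ) ≤ N := by exact_mod_cast hN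
  have hγ' : 1 - γ ^ 2 < 0 := sub_neg.mpr ((one_lt_sq_iff_one_lt_abs γ).mpr hγ)
  have hpos : 0 < (2 * (N : ℝ) - 1) * ((N : ℝ) - 1) ^ 2 :=
    mul_pos (by linarith) (pow_pos (by linarith) 2)
  obtain ⟨k₁, k₂, h₁, h₂, h⟩ := exists_roots_of_leadingCoeff_mul_eval_neg
    (a := (2 * (N : ℝ) - 1) * (γ + 1)) (b := -(2 * ((N : ℝ) ^ 2 * γ + 2 * (N : ℝ) - 1)))
    (c := (N : ℝ) ^ 2 * (γ + 1)) (x := 1)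
    (by linarith [mul_neg_of_pos_of_neg hpos hγ'])
  simp only [neg_mul, ← sub_eq_add_neg] at h
  refine ⟨⟨k₁, k₂, h₁, h₂, h⟩, k₂, ⟨h₂, (h k₂).mpr (Or.inr rfl)⟩, ?_⟩
  rintro k ⟨hk, hroot⟩
  exact ((h k).mp hroot).resolve_left (h₁.trans hk).ne'
end

section
/- Let γ be a real number with |γ| > 1, let k > 1, and set λ := √(k² − 2k/(γ+1)). Then there exist no real numbers z, w with w ≠ 0 satisfying simultaneously (w² + k²z²)^k = (w² + λ²z²)^(k−1) and k·(w² + k²z²)^(k−1) = (k−1)·(w² + λ²z²)^(k−2). (Equivalently, on the curve Γ = {(z,w) : (w² + k²z²)^k = (w² + λ²z²)^(k−1), w² + z² ≠ 0}, the partial derivative in w of F(z,w) = (w² + k²z²)^k − (w² + λ²z²)^(k−1) vanishes only at the two points where w = 0.) -/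
/-- Let `|γ| > 1`, `k > 1`, `λ := √(k² − 2k/(γ+1))`. Then there are no reals `z, w`
with `w ≠ 0` satisfying both `(w²+k²z²)^k = (w²+λ²z²)^(k−1)` and
`k(w²+k²z²)^(k−1) = (k−1)(w²+λ²z²)^(k−2)`. -/
theorem no_critical_points (γ k : ℝ) (hγ : 1 < |γ|) (hk : 1 < k)
    (lam : ℝ) (hlam : lam = Real.sqrt (k ^ 2 - 2 * k / (γ + 1))) :
    ¬ ∃ z w : ℝ, w ≠ 0
      ∧ (w ^ 2 + k ^ 2 * z ^ 2) ^ k = (w ^ 2 + lam ^ 2 * z ^ 2) ^ (k - 1)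
      ∧ k * (w ^ 2 + k ^ 2 * z ^ 2) ^ (k - 1)
          = (k - 1) * (w ^ 2 + lam ^ 2 * z ^ 2) ^ (k - 2) := by
  rintro ⟨z, w, hw, hF, hdF⟩
  have hw2 : 0 < w ^ 2 := by positivity
  have hγ' : γ + 1 ≠ 0 := fun h ↦ by
    rw [eq_neg_of_add_eq_zero_left h] at hγ
    norm_num at hγ
  have hratio : 0 < (γ - 1) / (γ + 1) := by
    rcases lt_abs.mp hγ with h | h
    · exact div_pos (by linarith) (by linarith)
    · exact div_pos_of_neg_of_neg (by linarith) (by linarith)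
  have hsplit : (γ - 1) / (γ + 1) = 1 - 2 / (γ + 1) := by
    field_simp
    ring
  have hlam2 : lam ^ 2 = k ^ 2 - 2 * k / (γ + 1) := by
    rw [hlam, Real.sq_sqrt]
    rw [mul_comm 2 k, mul_div_assoc]
    nlinarith
  have hA : 0 < w ^ 2 + k ^ 2 * z ^ 2 := by positivity
  have hB : 0 < w ^ 2 + lam ^ 2 * z ^ 2 := by positivity
  have hprop : k * (w ^ 2 + lam ^ 2 * z ^ 2) = (k - 1) * (w ^ 2 + k ^ 2 * z ^ 2) := by
    have hApow := Real.rpow_add_one hA.ne' (k - 1)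
    have hBpow := Real.rpow_add_one hB.ne' (k - 2)
    rw [show k - 1 + 1 = k by ring] at hApow
    rw [show k - 2 + 1 = k - 1 by ring] at hBpow
    apply mul_left_cancel₀ (Real.rpow_pos_of_pos hB (k - 2)).ne'
    linear_combination
      -k * hBpow - k * hF + k * hApow + (w ^ 2 + k ^ 2 * z ^ 2) * hdF
  have hzero : w ^ 2 + k ^ 2 * z ^ 2 * ((γ - 1) / (γ + 1)) = 0 := by
    rw [hlam2] at hprop
    rw [hsplit]
    linear_combination hprop
  have : 0 ≤ k ^ 2 * z ^ 2 * ((γ - 1) / (γ + 1)) := by positivity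
  linarith
end

section
/- Let γ ∈ ℚ with |γ| > 1, let N ≥ 2 be an integer, let k be the unique root with k > 1 of the characteristic equation (2N−1)(γ+1)k² − 2(N²γ + 2N − 1)k + N²(γ+1) = 0, set λ := √(k² − 2k/(γ+1)) and μ := (k+λ)/(k−λ). Then the three conditions k ∈ ℚ, λ ∈ ℚ, and μ ∈ ℚ are pairwise equivalent. -/
/-- For a root `k ≥ 1` of the characteristic equation, the radicand defining `λ` is the square of
`n (k - 1) / (n - 1)`. -/
lemma sqrt_eq_of_characteristic_eq {γ n k : ℝ} (hγ : γ + 1 ≠ 0) (hn : 1 < n) (hk1 : 1 ≤ k)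
    (hk : (2 * n - 1) * (γ + 1) * k ^ 2 - 2 * (n ^ 2 * γ + 2 * n - 1) * k
      + n ^ 2 * (γ + 1) = 0) :
    Real.sqrt (k ^ 2 - 2 * k / (γ + 1)) = n * (k - 1) / (n - 1) := by
  have hn1 : 0 < n - 1 := by linarith
  have hsq : k ^ 2 - 2 * k / (γ + 1) = (n * (k - 1) / (n - 1)) ^ 2 := by
    field_simp
    linear_combination -hk
  rw [hsq, Real.sqrt_sq]
  exact div_nonneg (mul_nonneg (by linarith) (by linarith)) hn1.le


/-- Let `γ ∈ ℚ`, `|γ| > 1`, `N ≥ 2`, `k` the unique root `> 1` of the characteristic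
equation, `λ := √(k² − 2k/(γ+1))`, `μ := (k+λ)/(k−λ)`. Then the conditions `k ∈ ℚ`,
`λ ∈ ℚ`, `μ ∈ ℚ` are pairwise equivalent. -/
theorem rationality_equivalences (γ : ℚ) (hγ : 1 < |γ|) (N : ℕ) (hN : 2 ≤ N)
    (k : ℝ) (hk1 : 1 < k)
    (hk : (2 * (N : ℝ) - 1) * ((γ : ℝ) + 1) * k ^ 2
        - 2 * ((N : ℝ) ^ 2 * (γ : ℝ) + 2 * (N : ℝ) - 1) * k
        + (N : ℝ) ^ 2 * ((γ : ℝ) + 1) = 0)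
    (lam : ℝ) (hlam : lam = Real.sqrt (k ^ 2 - 2 * k / ((γ : ℝ) + 1)))
    (μ : ℝ) (hμ : μ = (k + lam) / (k - lam)) :
    ((∃ a : ℚ, k = (a : ℝ)) ↔ (∃ a : ℚ, lam = (a : ℝ)))
    ∧ ((∃ a : ℚ, k = (a : ℝ)) ↔ (∃ a : ℚ, μ = (a : ℝ))) := by
  have hγR : (γ : ℝ) + 1 ≠ 0 := by
    intro h
    have h' : γ = -1 := by
      have : γ + 1 = 0 := by exact_mod_cast h
      linarith
    norm_num [h'] at hγ
  have hN2 : (2 : ℝ) ≤ N := by exact_mod_cast hN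
  have hN1 : (N : ℝ) - 1 ≠ 0 := by linarith
  have hN0 : (N : ℝ) ≠ 0 := by linarith
  have hlin : lam = N * (k - 1) / (N - 1) :=
    hlam.trans (sqrt_eq_of_characteristic_eq hγR (by linarith) hk1.le hk)
  have hkN : (N : ℝ) - k ≠ 0 := by
    intro h
    have hkN' : k = N := by linarith
    rw [hkN'] at hk
    have hprod : (N : ℝ) * (N - 1) ^ 2 = 0 := by linear_combination hk / 2
    exact mul_ne_zero hN0 (pow_ne_zero 2 hN1) hprod
  have hμk : μ * (N - k) = (2 * N - 1) * k - N := by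
    have hsub : k - lam = (N - k) / (N - 1) := by
      rw [hlin]
      field_simp
      ring
    have hadd : k + lam = ((2 * N - 1) * k - N) / (N - 1) := by
      rw [hlin]
      field_simp
      ring
    rw [hμ, hsub, hadd]
    field_simp
  refine ⟨⟨?_, ?_⟩, ⟨?_, ?_⟩⟩
  · rintro ⟨a, rfl⟩
    exact ⟨N * (a - 1) / (N - 1), by rw [hlin]; push_cast; rfl⟩
  · rintro ⟨a, rfl⟩
    refine ⟨a * (N - 1) / N + 1, ?_⟩
    push_cast
    rw [hlin]
    field_simp
    ring
  · rintro ⟨a, rfl⟩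
    refine ⟨((2 * N - 1) * a - N) / (N - a), ?_⟩
    push_cast
    exact eq_div_of_mul_eq hkN hμk
  · rintro ⟨a, rfl⟩
    refine ⟨N * (a + 1) / (a + 2 * N - 1), ?_⟩
    push_cast
    refine eq_div_of_mul_eq ?_ (by linear_combination -hμk)
    intro h
    have hprod : (N : ℝ) * (N - 1) = 0 := by
      linear_combination (-hμk + (N - k) * h) / 2
    exact mul_ne_zero hN0 hN1 hprod
end

section
/- For a real number γ with |γ| > 1 and an integer N ≥ 2, let k(γ,N) denote the unique root k > 1 of the characteristic equation (2N−1)(γ+1)k² − 2(N²γ + 2N − 1)k + N²(γ+1) = 0. Then for every such γ and N the identity k(γ,N)·(1+γ) + k(−γ,N)·(1−γ) = 2 holds. -/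
/-- Two roots of a real quadratic with positive leading coefficient that lie strictly on the same
side of a point where the quadratic is negative coincide. -/
theorem eq_of_quadratic_roots_same_side {a b c x z t : ℝ} (ha : 0 < a)
    (hx : a * x ^ 2 + b * x + c = 0) (hz : a * z ^ 2 + b * z + c = 0)
    (ht : a * t ^ 2 + b * t + c < 0) (hside : 0 < (x - t) * (z - t)) : x = z := by
  by_contra hne
  have hsum : a * (x + z) + b = 0 := by
    apply mul_left_cancel₀ (sub_ne_zero.mpr hne)
    linear_combination hx - hz
  have hval : a * ((x - t) * (z - t)) = a * t ^ 2 + b * t + c := by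
    linear_combination (x - t) * hsum - hx
  linarith [mul_pos ha hside]

/-- For `|γ| > 1` and `N ≥ 2`, let `k(γ,N)` be the unique root `k > 1` of the
characteristic equation. Then `k(γ,N)(1+γ) + k(−γ,N)(1−γ) = 2`. -/
theorem conjugate_exponent_identity (γ : ℝ) (hγ : 1 < |γ|) (N : ℕ) (hN : 2 ≤ N)
    (k k' : ℝ) (hk1 : 1 < k) (hk'1 : 1 < k')
    (hk : (2 * (N : ℝ) - 1) * (γ + 1) * k ^ 2
        - 2 * ((N : ℝ) ^ 2 * γ + 2 * (N : ℝ) - 1) * k + (N : ℝ) ^ 2 * (γ + 1) = 0)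
    (hk' : (2 * (N : ℝ) - 1) * (-γ + 1) * k' ^ 2
        - 2 * ((N : ℝ) ^ 2 * (-γ) + 2 * (N : ℝ) - 1) * k' + (N : ℝ) ^ 2 * (-γ + 1) = 0) :
    k * (1 + γ) + k' * (1 - γ) = 2 := by
  have hN' : (2 : ℝ) ≤ N := by exact_mod_cast hN
  have hγ2 : 1 < γ ^ 2 := one_lt_sq_iff_one_lt_abs γ |>.mpr hγ
  have hxz : k * (1 + γ) = 2 - k' * (1 - γ) := by
    apply eq_of_quadratic_roots_same_side (a := 2 * (N : ℝ) - 1)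
      (b := -2 * ((N : ℝ) ^ 2 * γ + 2 * (N : ℝ) - 1)) (c := (N : ℝ) ^ 2 * (1 + γ) ^ 2)
      (t := 1 + γ) (by linarith)
    · linear_combination (1 + γ) * hk
    · linear_combination (1 - γ) * hk'
    · have hpos : 0 < (γ ^ 2 - 1) * ((N : ℝ) - 1) ^ 2 :=
        mul_pos (by linarith) (pow_pos (by linarith) 2)
      linarith
    · have hpos : 0 < (γ ^ 2 - 1) * ((k - 1) * (k' - 1)) :=
        mul_pos (by linarith) (mul_pos (by linarith) (by linarith))
      linarith
  linarith
end

section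
/- For a real number γ with |γ| > 1 and an integer N ≥ 2, let k(γ,N) denote the unique root k > 1 of the characteristic equation (2N−1)(γ+1)k² − 2(N²γ + 2N − 1)k + N²(γ+1) = 0. Then for γ ∈ ℚ with |γ| > 1 and any integer N ≥ 2, k(γ,N) is rational if and only if k(−γ,N) is rational. -/
/-- The characteristic equations for `γ` and `-γ` have the same discriminant, so a rational root
of the first forces every root of the second to be rational. -/
theorem rational_root_neg_of_rational_root (γ : ℚ) (hγ : γ ≠ 1) (N : ℕ) (a : ℚ) (k' : ℝ)
    (hk : (2 * (N : ℝ) - 1) * ((γ : ℝ) + 1) * (a : ℝ) ^ 2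
        - 2 * ((N : ℝ) ^ 2 * (γ : ℝ) + 2 * (N : ℝ) - 1) * (a : ℝ)
        + (N : ℝ) ^ 2 * ((γ : ℝ) + 1) = 0)
    (hk' : (2 * (N : ℝ) - 1) * (-(γ : ℝ) + 1) * k' ^ 2
        - 2 * ((N : ℝ) ^ 2 * (-(γ : ℝ)) + 2 * (N : ℝ) - 1) * k'
        + (N : ℝ) ^ 2 * (-(γ : ℝ) + 1) = 0) :
    ∃ b : ℚ, k' = (b : ℝ) := by
  have hM : 2 * (N : ℝ) - 1 ≠ 0 := fun h => by
    have : 2 * N = 1 := by exact_mod_cast sub_eq_zero.mp h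
    lia
  have hγ' : -(γ : ℝ) + 1 ≠ 0 := fun h => hγ (by
    have : (γ : ℝ) = 1 := by linarith
    exact_mod_cast this)
  have hsq : ((2 * (N : ℝ) - 1) * (-(γ : ℝ) + 1) * k'
        - ((N : ℝ) ^ 2 * (-(γ : ℝ)) + 2 * (N : ℝ) - 1)) ^ 2
      = ((2 * (N : ℝ) - 1) * ((γ : ℝ) + 1) * (a : ℝ)
        - ((N : ℝ) ^ 2 * (γ : ℝ) + 2 * (N : ℝ) - 1)) ^ 2 := by
    linear_combination (2 * (N : ℝ) - 1) * (-(γ : ℝ) + 1) * hk'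
      - (2 * (N : ℝ) - 1) * ((γ : ℝ) + 1) * hk
  rcases sq_eq_sq_iff_eq_or_eq_neg.mp hsq with h | h
  · refine ⟨(((2 * N - 1) * (γ + 1) * a - (N ^ 2 * γ + 2 * N - 1))
      + (N ^ 2 * (-γ) + 2 * N - 1)) / ((2 * N - 1) * (-γ + 1)), ?_⟩
    push_cast
    rw [eq_div_iff (mul_ne_zero hM hγ')]
    linear_combination h
  · refine ⟨(-((2 * N - 1) * (γ + 1) * a - (N ^ 2 * γ + 2 * N - 1))
      + (N ^ 2 * (-γ) + 2 * N - 1)) / ((2 * N - 1) * (-γ + 1)), ?_⟩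
    push_cast
    rw [eq_div_iff (mul_ne_zero hM hγ')]
    linear_combination h

/-- For `γ ∈ ℚ` with `|γ| > 1` and integer `N ≥ 2`, let `k(γ,N)` (resp. `k(−γ,N)`)
be the unique root `> 1` of the characteristic equation for `γ` (resp. `−γ`).
Then `k(γ,N)` is rational iff `k(−γ,N)` is rational. -/
theorem conjugate_rationality (γ : ℚ) (hγ : 1 < |γ|) (N : ℕ) (hN : 2 ≤ N)
    (k k' : ℝ) (hk1 : 1 < k) (hk'1 : 1 < k')
    (hk : (2 * (N : ℝ) - 1) * ((γ : ℝ) + 1) * k ^ 2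
        - 2 * ((N : ℝ) ^ 2 * (γ : ℝ) + 2 * (N : ℝ) - 1) * k
        + (N : ℝ) ^ 2 * ((γ : ℝ) + 1) = 0)
    (hk' : (2 * (N : ℝ) - 1) * (-(γ : ℝ) + 1) * k' ^ 2
        - 2 * ((N : ℝ) ^ 2 * (-(γ : ℝ)) + 2 * (N : ℝ) - 1) * k'
        + (N : ℝ) ^ 2 * (-(γ : ℝ) + 1) = 0) :
    (∃ a : ℚ, k = (a : ℝ)) ↔ (∃ a : ℚ, k' = (a : ℝ)) := by
  have h1 : γ ≠ 1 := by
    rintro rfl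
    simp at hγ
  have h2 : -γ ≠ 1 := fun h => by
    rw [← abs_neg, h, abs_one] at hγ
    exact lt_irrefl _ hγ
  constructor
  · rintro ⟨a, rfl⟩
    exact rational_root_neg_of_rational_root γ h1 N a k' hk hk'
  · rintro ⟨a, rfl⟩
    refine rational_root_neg_of_rational_root (-γ) h2 N a k ?_ ?_
    · simpa only [Rat.cast_neg] using hk'
    · simpa only [Rat.cast_neg, neg_neg] using hk
end

section
/- Let p > q ≥ 1 be coprime positive integers and N ≥ 2 an integer, and set γ = p/q. Then the following are equivalent: (i) k(γ,N), the unique root k > 1 of the characteristic equation (2N−1)(γ+1)k² − 2(N²γ + 2N − 1)k + N²(γ+1) = 0, is a rational number; (ii) there exist integers A > B ≥ 1 satisfying the diophantine equation A²q − 2ABpN + q(2N−1)B² = 0; (iii) the integer D = N²p² − q²(2N−1) is a perfect square. -/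
/-- After clearing denominators and completing the square, the characteristic equation has
discriminant `(N - 1)² (N² p² - q² (2N - 1))` up to a factor `4`. -/
theorem characteristic_eq_iff {p q N k : ℝ} (hq : 0 < q) (hp : 0 < p) (hN : 2 ≤ N) :
    (2 * N - 1) * (p / q + 1) * k ^ 2 - 2 * (N ^ 2 * (p / q) + 2 * N - 1) * k
        + N ^ 2 * (p / q + 1) = 0 ↔
      ((2 * N - 1) * (p + q) * k - (N ^ 2 * p + (2 * N - 1) * q)) ^ 2
        = (N - 1) ^ 2 * (N ^ 2 * p ^ 2 - q ^ 2 * (2 * N - 1)) := by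
  have ha : 0 < (2 * N - 1) * (p + q) := mul_pos (by linarith) (by linarith)
  have key : q * ((2 * N - 1) * (p + q)) *
      ((2 * N - 1) * (p / q + 1) * k ^ 2 - 2 * (N ^ 2 * (p / q) + 2 * N - 1) * k
        + N ^ 2 * (p / q + 1)) =
      ((2 * N - 1) * (p + q) * k - (N ^ 2 * p + (2 * N - 1) * q)) ^ 2
        - (N - 1) ^ 2 * (N ^ 2 * p ^ 2 - q ^ 2 * (2 * N - 1)) := by
    field_simp
    ring
  rw [← sub_eq_zero (b := (N - 1) ^ 2 * _), ← key, mul_eq_zero,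
    or_iff_right (mul_pos hq ha).ne']

theorem characteristic_root_rational_iff {p q N : ℕ} (hq : 1 ≤ q) (hpq : q < p) (hN : 2 ≤ N) :
    (∀ k : ℝ, 1 < k →
        (2 * (N : ℝ) - 1) * ((p : ℝ) / (q : ℝ) + 1) * k ^ 2
          - 2 * ((N : ℝ) ^ 2 * ((p : ℝ) / (q : ℝ)) + 2 * (N : ℝ) - 1) * k
          + (N : ℝ) ^ 2 * ((p : ℝ) / (q : ℝ) + 1) = 0 →
        ∃ a : ℚ, k = (a : ℝ)) ↔
      ∃ d : ℤ, (N : ℤ) ^ 2 * (p : ℤ) ^ 2 - (q : ℤ) ^ 2 * (2 * (N : ℤ) - 1) = d ^ 2 := by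
  have hqR : (1 : ℝ) ≤ q := by exact_mod_cast hq
  have hpqR : (q : ℝ) < p := by exact_mod_cast hpq
  have hNR : (2 : ℝ) ≤ N := by exact_mod_cast hN
  have hq0 : (0 : ℝ) < q := by linarith
  have hp0 : (0 : ℝ) < p := by linarith
  have ha : 0 < (2 * (N : ℝ) - 1) * (p + q) := mul_pos (by linarith) (by linarith)
  have hN1 : (0 : ℝ) < N - 1 := by linarith
  simp only [characteristic_eq_iff hq0 hp0 hNR]
  constructor
  · intro h
    set D : ℝ := (N : ℝ) ^ 2 * p ^ 2 - q ^ 2 * (2 * N - 1) with hD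
    have hDnn : 0 ≤ D := by
      have h1 : (q : ℝ) ^ 2 * (2 * N - 1) ≤ q ^ 2 * N ^ 2 := by
        gcongr
        nlinarith [sq_nonneg ((N : ℝ) - 1)]
      have h2 : (q : ℝ) ^ 2 * N ^ 2 ≤ p ^ 2 * N ^ 2 := by gcongr
      linarith
    obtain ⟨r, hr⟩ := h
      (((N : ℝ) ^ 2 * p + (2 * N - 1) * q + (N - 1) * √D) / ((2 * N - 1) * (p + q)))
      (by
        rw [one_lt_div ha]
        nlinarith [mul_pos (pow_pos hN1 2) hp0, mul_nonneg hN1.le (Real.sqrt_nonneg D)])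
      (by
        rw [mul_div_cancel₀ _ ha.ne', add_sub_cancel_left, mul_pow, Real.sq_sqrt hDnn])
    have hs : √D = (((2 * N - 1) * (p + q) * r - (N ^ 2 * p + (2 * N - 1) * q)) / (N - 1) : ℚ) := by
      push_cast
      rw [← hr, mul_div_cancel₀ _ ha.ne', add_sub_cancel_left, mul_div_cancel_left₀ _ hN1.ne']
    generalize (((2 * N - 1) * (p + q) * r - (N ^ 2 * p + (2 * N - 1) * q)) / (N - 1) : ℚ) = s at hs
    have hsq : (((N : ℤ) ^ 2 * (p : ℤ) ^ 2 - (q : ℤ) ^ 2 * (2 * (N : ℤ) - 1) : ℤ) : ℚ) = s * s := by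
      have : D = (s : ℝ) * s := by rw [← hs, Real.mul_self_sqrt hDnn]
      rw [hD] at this
      exact_mod_cast this
    obtain ⟨d, hd⟩ := Rat.isSquare_intCast_iff.mp ⟨s, hsq⟩
    exact ⟨d, hd.trans (sq d).symm⟩
  · rintro ⟨d, hd⟩ k - hk
    have hdR : (N : ℝ) ^ 2 * p ^ 2 - q ^ 2 * (2 * N - 1) = d ^ 2 := by exact_mod_cast hd
    rw [hdR, ← mul_pow, sq_eq_sq_iff_eq_or_eq_neg] at hk
    rcases hk with hk | hk
    · refine ⟨((N - 1) * d + (N ^ 2 * p + (2 * N - 1) * q)) / ((2 * N - 1) * (p + q)), ?_⟩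
      push_cast
      rw [eq_div_iff ha.ne']
      linarith
    · refine ⟨(-((N - 1) * d) + (N ^ 2 * p + (2 * N - 1) * q)) / ((2 * N - 1) * (p + q)), ?_⟩
      push_cast
      rw [eq_div_iff ha.ne']
      linarith

theorem diophantine_solvable_iff {p q N : ℕ} (hq : 1 ≤ q) (hpq : q < p) (hN : 2 ≤ N) :
    (∃ A B : ℤ, 1 ≤ B ∧ B < A ∧
        A ^ 2 * (q : ℤ) - 2 * A * B * (p : ℤ) * (N : ℤ)
          + (q : ℤ) * (2 * (N : ℤ) - 1) * B ^ 2 = 0) ↔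
      ∃ d : ℤ, (N : ℤ) ^ 2 * (p : ℤ) ^ 2 - (q : ℤ) ^ 2 * (2 * (N : ℤ) - 1) = d ^ 2 := by
  constructor
  · rintro ⟨A, B, hB, -, h⟩
    have hsq : (A * q - B * p * N) ^ 2
        = B ^ 2 * ((N : ℤ) ^ 2 * (p : ℤ) ^ 2 - (q : ℤ) ^ 2 * (2 * (N : ℤ) - 1)) := by
      linear_combination (q : ℤ) * h
    obtain ⟨d, hd⟩ := (Int.pow_dvd_pow_iff two_ne_zero).mp (Dvd.intro _ hsq.symm)
    rw [hd, mul_pow] at hsq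
    exact ⟨d, (mul_left_cancel₀ (pow_ne_zero 2 (by lia)) hsq).symm⟩
  · rintro ⟨d, hd⟩
    refine ⟨p * N + |d|, q, by exact_mod_cast hq, ?_, ?_⟩
    · have : (q : ℤ) < p := by exact_mod_cast hpq
      have : (2 : ℤ) ≤ N := by exact_mod_cast hN
      nlinarith [abs_nonneg d]
    · linear_combination (q : ℤ) * sq_abs d - (q : ℤ) * hd

/-- Let `p > q ≥ 1` be coprime positive integers, `N ≥ 2`, `γ = p/q`. TFAE:
(i) the unique root `k > 1` of the characteristic equation is rational;
(ii) there exist integers `A > B ≥ 1` with `A²q − 2ABpN + q(2N−1)B² = 0`;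
(iii) `D = N²p² − q²(2N−1)` is a perfect square. -/
theorem algebraicity_criterion (p q N : ℕ) (hq : 1 ≤ q) (hpq : q < p)
    (hcop : Nat.Coprime p q) (hN : 2 ≤ N) :
    ((∀ k : ℝ, 1 < k →
        (2 * (N : ℝ) - 1) * ((p : ℝ) / (q : ℝ) + 1) * k ^ 2
          - 2 * ((N : ℝ) ^ 2 * ((p : ℝ) / (q : ℝ)) + 2 * (N : ℝ) - 1) * k
          + (N : ℝ) ^ 2 * ((p : ℝ) / (q : ℝ) + 1) = 0 →
        ∃ a : ℚ, k = (a : ℝ))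
      ↔ (∃ A B : ℤ, 1 ≤ B ∧ B < A ∧
          A ^ 2 * (q : ℤ) - 2 * A * B * (p : ℤ) * (N : ℤ)
            + (q : ℤ) * (2 * (N : ℤ) - 1) * B ^ 2 = 0))
    ∧ ((∃ A B : ℤ, 1 ≤ B ∧ B < A ∧
          A ^ 2 * (q : ℤ) - 2 * A * B * (p : ℤ) * (N : ℤ)
            + (q : ℤ) * (2 * (N : ℤ) - 1) * B ^ 2 = 0)
      ↔ (∃ d : ℤ, (N : ℤ) ^ 2 * (p : ℤ) ^ 2 - (q : ℤ) ^ 2 * (2 * (N : ℤ) - 1) = d ^ 2)) := by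
  exact ⟨(characteristic_root_rational_iff hq hpq hN).trans (diophantine_solvable_iff hq hpq hN).symm,
    diophantine_solvable_iff hq hpq hN⟩
end

section
/- Let p > q ≥ 1 be coprime positive integers and N ≥ 2 an integer, and suppose the integer N²p² − q²(2N−1) is a perfect square. Then: (a) 2Np² < q²(p² + 2 − q²); (b) q ≥ 3; (c) q + 1 ≤ p ≤ q² − 1. -/
/-- If `e ≥ 0` and `e² = N²p² − q²(2N−1)`, then `pe > Np² − q²`, because
`(pe)² = (Np² − q²)² + q²(p² − q²)`. -/
lemma sub_sq_lt_mul_of_sq_eq {p q N e : ℤ} (hq : 0 < q) (hpq : q < p) (he : 0 ≤ e)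
    (h : N ^ 2 * p ^ 2 - q ^ 2 * (2 * N - 1) = e ^ 2) : N * p ^ 2 - q ^ 2 < p * e := by
  have hid : (p * e) ^ 2 = (N * p ^ 2 - q ^ 2) ^ 2 + q ^ 2 * (p ^ 2 - q ^ 2) := by
    linear_combination (-p ^ 2) * h
  have hlt : q ^ 2 < p ^ 2 := by nlinarith
  have hpos : 0 < q ^ 2 * (p ^ 2 - q ^ 2) := mul_pos (by positivity) (by linarith)
  exact lt_of_pow_lt_pow_left₀ 2 (mul_nonneg (by linarith) he) (by linarith)

/-- Let `p > q ≥ 1` be coprime positive integers, `N ≥ 2`, and suppose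
`N²p² − q²(2N−1)` is a perfect square. Then (a) `2Np² < q²(p² + 2 − q²)`;
(b) `q ≥ 3`; (c) `q + 1 ≤ p ≤ q² − 1`. -/
theorem finiteness_bounds (p q N : ℕ) (hq : 1 ≤ q) (hpq : q < p)
    (hcop : Nat.Coprime p q) (hN : 2 ≤ N)
    (hD : ∃ d : ℤ, (N : ℤ) ^ 2 * (p : ℤ) ^ 2 - (q : ℤ) ^ 2 * (2 * (N : ℤ) - 1) = d ^ 2) :
    2 * (N : ℤ) * (p : ℤ) ^ 2 < (q : ℤ) ^ 2 * ((p : ℤ) ^ 2 + 2 - (q : ℤ) ^ 2)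
    ∧ 3 ≤ q
    ∧ q + 1 ≤ p ∧ (p : ℤ) ≤ (q : ℤ) ^ 2 - 1 := by
  obtain ⟨d, hd⟩ := hD
  rw [← sq_abs d] at hd
  have he := abs_nonneg d
  generalize |d| = e at hd he
  have hq' : (1 : ℤ) ≤ q := by exact_mod_cast hq
  have hpq' : (q : ℤ) < p := by exact_mod_cast hpq
  have hN' : (2 : ℤ) ≤ N := by exact_mod_cast hN
  have hlt := sub_sq_lt_mul_of_sq_eq (by linarith) hpq' he hd
  have hbound : 2 * (N : ℤ) * (p : ℤ) ^ 2 < (q : ℤ) ^ 2 * ((p : ℤ) ^ 2 + 2 - (q : ℤ) ^ 2) := by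
    have hA : 0 ≤ (N : ℤ) * (p : ℤ) ^ 2 - (q : ℤ) ^ 2 := by nlinarith
    have hsq : ((N : ℤ) * (p : ℤ) ^ 2 - (q : ℤ) ^ 2 + 1) ^ 2 ≤ ((p : ℤ) * e) ^ 2 :=
      pow_le_pow_left₀ (by linarith) hlt 2
    rw [mul_pow, ← hd] at hsq
    linarith
  refine ⟨hbound, ?_, hpq, ?_⟩
  · by_contra! hq3
    have hmul : 2 * (p : ℤ) ^ 2 ≤ N * (p : ℤ) ^ 2 :=
      mul_le_mul_of_nonneg_right hN' (by positivity)
    interval_cases q <;> norm_num at hbound <;> nlinarith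
  · have heN : e < N * p := by
      have hpos : 0 < (q : ℤ) ^ 2 * (2 * N - 1) := mul_pos (by positivity) (by linarith)
      exact lt_of_pow_lt_pow_left₀ 2 (by positivity) (by rw [mul_pow]; linarith)
    have hpe : (p : ℤ) * e ≤ p * (N * p - 1) :=
      mul_le_mul_of_nonneg_left (by linarith) (by linarith)
    linarith
end

section
/- Let γ ∈ ℚ with γ > 1 and let N ≥ 2 be an integer. Then N²γ² − 2N + 1 is the square of a rational number if and only if there exists a rational number s with 0 < s < 1 such that γ = (2N − 1 + s²)/(2sN). -/
/-- Let `γ ∈ ℚ`, `γ > 1`, `N ≥ 2`. Then `N²γ² − 2N + 1` is the square of a rational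
iff there is a rational `s` with `0 < s < 1` and `γ = (2N−1+s²)/(2sN)`. -/
theorem rational_parametrization (γ : ℚ) (hγ : 1 < γ) (N : ℕ) (hN : 2 ≤ N) :
    (∃ t : ℚ, (N : ℚ) ^ 2 * γ ^ 2 - 2 * (N : ℚ) + 1 = t ^ 2)
      ↔ (∃ s : ℚ, 0 < s ∧ s < 1 ∧ γ = (2 * (N : ℚ) - 1 + s ^ 2) / (2 * s * (N : ℚ))) := by
  have hN' : (2 : ℚ) ≤ N := by exact_mod_cast hN
  constructor
  · rintro ⟨t, ht⟩
    rw [← sq_abs t] at ht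
    have hpos : 0 < N * γ - |t| :=
      sub_pos.2 (lt_of_pow_lt_pow_left₀ 2 (by positivity) (by linarith [mul_pow (N : ℚ) γ 2]))
    have hlt : N * γ - 1 < |t| :=
      lt_of_pow_lt_pow_left₀ 2 (abs_nonneg t) (by nlinarith)
    refine ⟨N * γ - |t|, hpos, by linarith, ?_⟩
    rw [eq_div_iff (by positivity)]
    linear_combination ht
  · rintro ⟨s, hs, -, h⟩
    rw [eq_div_iff (by positivity)] at h
    exact ⟨N * γ - s, by linear_combination h⟩
end

section
/- Let p > q ≥ 1 be coprime positive integers with q even, let N ≥ 2 be an integer, and suppose N²p² − q²(2N−1) is a perfect square. Then 2p ≤ q² − 2, and equality 2p = q² − 2 holds if and only if 4N = q² − 4. -/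
/-- Maximal series, even denominator. Let `p > q ≥ 1` be coprime with `q` even,
`N ≥ 2`, and suppose `N²p² − q²(2N−1)` is a perfect square. Then `2p ≤ q² − 2`,
with equality iff `4N = q² − 4`. -/
theorem maximal_series_even (p q N : ℕ) (hq : 1 ≤ q) (hqe : Even q) (hpq : q < p)
    (hcop : Nat.Coprime p q) (hN : 2 ≤ N)
    (hD : ∃ d : ℤ, (N : ℤ) ^ 2 * (p : ℤ) ^ 2 - (q : ℤ) ^ 2 * (2 * (N : ℤ) - 1) = d ^ 2) :
    2 * (p : ℤ) ≤ (q : ℤ) ^ 2 - 2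
    ∧ (2 * (p : ℤ) = (q : ℤ) ^ 2 - 2 ↔ 4 * (N : ℤ) = (q : ℤ) ^ 2 - 4) := by
  obtain ⟨d, hd⟩ := hD
  obtain ⟨a, rfl⟩ := hqe
  obtain ⟨k, hk⟩ : ∃ k : ℤ, |d| = N * p - k := ⟨N * p - |d|, by ring⟩
  have hdk : d ^ 2 = (N * p - k) ^ 2 := by rw [← hk, sq_abs]
  have hk0 : 0 ≤ (N : ℤ) * p - k := hk ▸ abs_nonneg d
  rw [hdk] at hd
  push_cast at hd ⊢
  have ha : (1 : ℤ) ≤ a := by omega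
  have hp : 2 * (a : ℤ) < p := by omega
  have hN' : (2 : ℤ) ≤ N := by omega
  clear hdk hk hcop hN hpq hq
  generalize (a : ℤ) = a at *
  generalize (p : ℤ) = p at *
  generalize (N : ℤ) = N at *
  have hNp : p ≤ N * p := by nlinarith
  have hkey : k ^ 2 - 4 * a ^ 2 = 2 * N * (p * k - 4 * a ^ 2) := by linear_combination -hd
  have hkpos : 0 < k := by
    by_contra! h
    have h1 : 0 ≤ -k * p := mul_nonneg (by linarith) (by linarith)
    nlinarith [mul_pos (show 0 < a by linarith) (show 0 < a by linarith)]
  have hklt : k < 2 * a := by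
    by_contra! h
    have h1 : 0 ≤ (k - 2 * a) * (2 * (N * p) - k - 2 * a) :=
      mul_nonneg (by linarith) (by linarith)
    have h2 : 0 < N * a * (p - 2 * a) :=
      mul_pos (mul_pos (by linarith) (by linarith)) (by linarith)
    nlinarith
  have hkeven : Even k := by
    have h : Even (k ^ 2) := ⟨2 * a ^ 2 + N * (p * k - 4 * a ^ 2), by linear_combination hkey⟩
    exact (Int.even_pow.mp h).1
  obtain ⟨b, rfl⟩ := hkeven
  have hb : 1 ≤ b := by omega
  have hba : b < a := by omega
  have hform : a ^ 2 - b ^ 2 = N * (2 * a ^ 2 - p * b) := by linarith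
  have hm : 1 ≤ 2 * a ^ 2 - p * b := by
    by_contra! h
    have h1 : N * (2 * a ^ 2 - p * b) ≤ 0 :=
      mul_nonpos_of_nonneg_of_nonpos (by linarith) (by linarith)
    nlinarith
  have hpb : p ≤ p * b := by nlinarith
  refine ⟨by linarith, fun h => ?_, fun h => ?_⟩
  · have hp' : p = 2 * a ^ 2 - 1 := by linarith
    have hb1 : b = 1 := by
      by_contra hne
      have : 2 ≤ b := by omega
      nlinarith
    subst hb1 hp'
    linarith
  · have hN1 : N = a ^ 2 - 1 := by linarith
    have h1 : N ≤ N * (2 * a ^ 2 - p * b) := by nlinarith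
    have hb1 : b = 1 := by nlinarith
    subst hb1
    have : N * (2 * a ^ 2 - p * 1) = N * 1 := by linarith
    have := mul_left_cancel₀ (by linarith) this
    linarith
end
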